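/- arXiv:2411.07985 — 2 statements merged into one kernel-verified Lean document; each statement's English description precedes it below -/
import Mathlib

section
/- Let F ⊆ 2^[n] be such that the connected components of the comparability graph G_F are induced by diamond subfamilies F_1,…,F_ℓ (i.e. F is the disjoint union of diamonds F_1,…,F_ℓ, and no member of F_p is comparable to a member of F_q for p ≠ q). For i, j ∈ {0,…,n}, let a_{i,j} denote the number of these diamonds whose bottom corner has i elements and whose top corner has i+j elements. Then Σ_{i=0}^n Σ_{j=0}^n a_{i,j} / C(n−j, i) ≤ 1. -/
open Finset in
/-- The weights in Bollobás's set-pairs inequality, averaged over the deletion of one element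
outside `A`. -/
theorem sum_sdiff_inv_choose_card_erase {α : Type*} [DecidableEq α] {S A B : Finset α}
    (hA : A ⊆ S) (hB : B ⊆ S) (hAB : Disjoint A B) (hne : B.Nonempty) :
    ∑ x ∈ S \ A, (((#A + #(B.erase x)).choose #A : ℕ) : ℝ)⁻¹ =
      #S * (((#A + #B).choose #A : ℕ) : ℝ)⁻¹ := by
  have hBS : B ⊆ S \ A := fun x hx =>
    mem_sdiff.2 ⟨hB hx, fun hxA => disjoint_left.1 hAB hxA hx⟩
  rw [← sum_sdiff hBS]
  have hout : ∀ x ∈ (S \ A) \ B, (((#A + #(B.erase x)).choose #A : ℕ) : ℝ)⁻¹ =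
      (((#A + #B).choose #A : ℕ) : ℝ)⁻¹ := fun x hx => by
    rw [erase_eq_of_notMem (mem_sdiff.1 hx).2]
  have hin : ∀ x ∈ B, (((#A + #(B.erase x)).choose #A : ℕ) : ℝ)⁻¹ =
      (((#A + (#B - 1)).choose #A : ℕ) : ℝ)⁻¹ := fun x hx => by
    rw [card_erase_of_mem hx]
  rw [sum_congr rfl hout, sum_congr rfl hin, sum_const, sum_const, nsmul_eq_mul, nsmul_eq_mul]
  have hcard : #((S \ A) \ B) + #B + #A = #S := by
    rw [card_sdiff_add_card_eq_card hBS, card_sdiff_add_card_eq_card hA]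
  obtain ⟨b, hb⟩ : ∃ b, #B = b + 1 := ⟨#B - 1, by have := hne.card_pos; omega⟩
  have hchoose : (((#A + b).choose #A : ℕ) : ℝ) * (#A + b + 1) =
      (((#A + (b + 1)).choose #A : ℕ) : ℝ) * (b + 1) := by
    have h := Nat.choose_mul_succ_eq (#A + b) #A
    rw [show #A + b + 1 - #A = b + 1 by omega] at h
    exact_mod_cast h
  have h₁ : (((#A + b).choose #A : ℕ) : ℝ) ≠ 0 :=
    Nat.cast_ne_zero.2 (Nat.choose_pos (Nat.le_add_right _ _)).ne'
  have h₂ : (((#A + (b + 1)).choose #A : ℕ) : ℝ) ≠ 0 :=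
    Nat.cast_ne_zero.2 (Nat.choose_pos (Nat.le_add_right _ _)).ne'
  rw [← hcard, hb, Nat.add_sub_cancel]
  push_cast
  field_simp
  linear_combination -hchoose

open Finset in
/-- **Bollobás's set-pairs inequality.** -/
theorem sum_inv_choose_card_le_one_of_setPairs {α ι : Type*} [DecidableEq α] (S : Finset α)
    (I : Finset ι) (A B : ι → Finset α) (hA : ∀ p ∈ I, A p ⊆ S) (hB : ∀ p ∈ I, B p ⊆ S)
    (hAB : ∀ p ∈ I, Disjoint (A p) (B p))
    (hcross : ∀ p ∈ I, ∀ q ∈ I, p ≠ q → ¬ Disjoint (A p) (B q)) :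
    ∑ p ∈ I, (((#(A p) + #(B p)).choose #(A p) : ℕ) : ℝ)⁻¹ ≤ 1 := by
  induction S using Finset.strongInduction generalizing I B with
  | H S ih =>
    by_cases hempty : ∃ q ∈ I, B q = ∅
    · obtain ⟨q, hq, hBq⟩ := hempty
      have hI : I = {q} := eq_singleton_iff_unique_mem.2 ⟨hq, fun p hp => by
        by_contra hpq
        exact hcross p hp q hq hpq (by simp [hBq])⟩
      simp [hI, hBq]
    · push Not at hempty
      obtain rfl | hI := I.eq_empty_or_nonempty
      · simp
      obtain ⟨q, hq⟩ := hI
      have hS : 0 < #S := ((hempty q hq).mono (hB q hq)).card_pos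
      have hdel : ∀ x ∈ S, ∑ p ∈ I with x ∉ A p,
          (((#(A p) + #((B p).erase x)).choose #(A p) : ℕ) : ℝ)⁻¹ ≤ 1 := by
        intro x hx
        refine ih (S.erase x) (erase_ssubset hx) _ (fun p => (B p).erase x) ?_ ?_ ?_ ?_
        · intro p hp
          rw [mem_filter] at hp
          exact subset_erase.2 ⟨hA p hp.1, hp.2⟩
        · intro p hp
          exact erase_subset_erase _ (hB p (mem_filter.1 hp).1)
        · intro p hp
          exact (hAB p (mem_filter.1 hp).1).mono_right (erase_subset _ _)
        · intro p hp r hr hpr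
          rw [mem_filter] at hp hr
          obtain ⟨y, hyA, hyB⟩ := not_disjoint_iff.1 (hcross p hp.1 r hr.1 hpr)
          exact not_disjoint_iff.2
            ⟨y, hyA, mem_erase.2 ⟨fun h => hp.2 (h ▸ hyA), hyB⟩⟩
      have hswap : ∑ x ∈ S, ∑ p ∈ I with x ∉ A p,
          (((#(A p) + #((B p).erase x)).choose #(A p) : ℕ) : ℝ)⁻¹ =
          #S * ∑ p ∈ I, (((#(A p) + #(B p)).choose #(A p) : ℕ) : ℝ)⁻¹ := by
        rw [mul_sum, sum_comm' (t' := I) (s' := fun p => S \ A p)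
          (by intro x p; simp only [mem_filter, mem_sdiff]; tauto)]
        exact sum_congr rfl fun p hp =>
          sum_sdiff_inv_choose_card_erase (hA p hp) (hB p hp) (hAB p hp) (hempty p hp)
      have htotal := sum_le_sum hdel
      rw [hswap, sum_const, nsmul_eq_mul] at htotal
      exact le_of_mul_le_mul_left htotal (Nat.cast_pos.2 hS)

/-- Diamond BLYM: if `F ⊆ 2^[n]` is the union of diamonds
`D_p = {X : A p ⊆ X ⊆ B p}`, `p ∈ Fin ℓ`, with no comparabilities between distinct
diamonds (so the diamonds induce the components of the comparability graph), and
`a_{i,j}` counts the diamonds with bottom corner on layer `i` and top corner on layer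
`i+j`, then `Σ_i Σ_j a_{i,j} / C(n-j, i) ≤ 1`. -/
theorem stmt7 (n ℓ : ℕ) (F : Finset (Finset (Fin n))) (A B : Fin ℓ → Finset (Fin n))
    (hAB : ∀ p, A p ⊆ B p)
    (hcover : ∀ X : Finset (Fin n), X ∈ F ↔ ∃ p, A p ⊆ X ∧ X ⊆ B p)
    (hincomp : ∀ p q, p ≠ q → ∀ X Y : Finset (Fin n),
      A p ⊆ X → X ⊆ B p → A q ⊆ Y → Y ⊆ B q → ¬ (X ⊆ Y ∨ Y ⊆ X)) :
    ∑ i ∈ Finset.range (n + 1), ∑ j ∈ Finset.range (n + 1),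
      (((Finset.univ : Finset (Fin ℓ)).filter
          (fun p => (A p).card = i ∧ (B p).card = i + j)).card : ℝ) /
        ((n - j).choose i : ℝ) ≤ 1 := by
  have hcard : ∀ p, (A p).card ≤ (B p).card ∧ (B p).card ≤ n := fun p =>
    ⟨Finset.card_le_card (hAB p), by simpa using Finset.card_le_univ (B p)⟩
  have hweight : ∑ i ∈ Finset.range (n + 1), ∑ j ∈ Finset.range (n + 1),
      (((Finset.univ : Finset (Fin ℓ)).filter
          (fun p => (A p).card = i ∧ (B p).card = i + j)).card : ℝ) /
        ((n - j).choose i : ℝ) =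
      ∑ p, ((((A p).card + (B p)ᶜ.card).choose (A p).card : ℕ) : ℝ)⁻¹ := by
    rw [← Finset.sum_product',
      ← Finset.sum_fiberwise_of_maps_to (t := Finset.range (n + 1) ×ˢ Finset.range (n + 1))
        (g := fun p => ((A p).card, (B p).card - (A p).card))
        (fun p _ => by
          have := hcard p
          simp only [Finset.mem_product, Finset.mem_range]
          omega)]
    refine Finset.sum_congr rfl fun x _ => ?_
    have hfiber : Finset.univ.filter
        (fun p => ((A p).card, (B p).card - (A p).card) = x) = Finset.univ.filter
        (fun p => (A p).card = x.1 ∧ (B p).card = x.1 + x.2) := by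
      ext p
      have := hcard p
      simp only [Finset.mem_filter, Finset.mem_univ, true_and, Prod.ext_iff]
      omega
    rw [hfiber, div_eq_mul_inv, ← nsmul_eq_mul, ← Finset.sum_const]
    refine Finset.sum_congr rfl fun p hp => ?_
    obtain ⟨hAp, hBp⟩ := (Finset.mem_filter.1 hp).2
    have := hcard p
    rw [Finset.card_compl, Fintype.card_fin, hAp, hBp,
      show x.1 + (n - (x.1 + x.2)) = n - x.2 by omega]
  rw [hweight]
  refine sum_inv_choose_card_le_one_of_setPairs Finset.univ Finset.univ A (fun p => (B p)ᶜ)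
    (fun p _ => Finset.subset_univ _) (fun p _ => Finset.subset_univ _)
    (fun p _ => disjoint_compl_right.mono_left (hAB p)) fun p _ q _ hpq hdisj => ?_
  exact hincomp p q hpq (A p) (B q) subset_rfl (hAB p) (hAB q) subset_rfl
    (Or.inl (disjoint_compl_right_iff.1 hdisj))
end

section
/- Let n, k ∈ ℕ with k ≤ n. If S ⊆ 2^[n] is a family of k+1 sets, each of size at least k, then |∂−(S)| ≥ 2^{k+1} − 1. If S' ⊆ 2^[n] is a family of k sets, each of size at least k, then |∂−(S')| ≥ 2^{k+1} − 2. Dually, if S ⊆ 2^[n] is a family of n−k+1 sets, each of size at most k, then |∂+(S)| ≥ 2^{n−k+1} − 1, and if S' ⊆ 2^[n] is a family of n−k sets, each of size at most k, then |∂+(S')| ≥ 2^{n−k+1} − 2. -/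
/-- `∂+(S)`: all supersets of members of `S`. -/
def upClosure (n : ℕ) (S : Finset (Finset (Fin n))) : Finset (Finset (Fin n)) :=
  Finset.univ.filter (fun X => ∃ A ∈ S, A ⊆ X)

/-- `∂−(S)`: all subsets of members of `S`. -/
def downClosure (n : ℕ) (S : Finset (Finset (Fin n))) : Finset (Finset (Fin n)) :=
  Finset.univ.filter (fun X => ∃ A ∈ S, X ⊆ A)

/-- If no member of `S` contains `A`, then `A` has many subsets lying in no member of `S`. -/
theorem two_pow_le_card_powerset_sdiff {α : Type*} [DecidableEq α] (A : Finset α)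
    (S : Finset (Finset α)) (hA : ∀ B ∈ S, ¬ A ⊆ B) :
    2 ^ (A.card - S.card) ≤ (A.powerset \ S.biUnion Finset.powerset).card := by
  have h : ∀ B : S, ∃ x ∈ A, x ∉ B.1 := fun B => Finset.not_subset.1 (hA B.1 B.2)
  choose f hfA hfB using h
  have hXA : Finset.univ.image f ⊆ A := Finset.image_subset_iff.2 fun B _ => hfA B
  have hcard : (Finset.univ.image f).card ≤ S.card :=
    Finset.card_image_le.trans (by simp)
  calc 2 ^ (A.card - S.card) ≤ 2 ^ (A.card - (Finset.univ.image f).card) :=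
        Nat.pow_le_pow_right two_pos (Nat.sub_le_sub_left hcard _)
    _ = (Finset.Icc (Finset.univ.image f) A).card := (Finset.card_Icc_finset hXA).symm
    _ ≤ _ := Finset.card_le_card fun Y hY => by
        simp only [Finset.mem_Icc, Finset.mem_sdiff, Finset.mem_powerset,
          Finset.mem_biUnion, not_exists, not_and] at hY ⊢
        exact ⟨hY.2, fun B hB hYB =>
          hfB ⟨B, hB⟩ (hYB (hY.1 (Finset.mem_image_of_mem f (Finset.mem_univ _))))⟩

/-- At most `k + 1` sets of size `k` have together at least `2 ^ k + 2 ^ (k - 1) + ⋯` subsets,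
with one summand for each set. -/
theorem two_pow_le_card_biUnion_powerset_add {α : Type*} [DecidableEq α] (k : ℕ)
    (S : Finset (Finset α)) (hS : ∀ X ∈ S, X.card = k) (hcard : S.card ≤ k + 1) :
    2 ^ (k + 1) ≤ (S.biUnion Finset.powerset).card + 2 ^ (k + 1 - S.card) := by
  induction S using Finset.induction_on with
  | empty => simp
  | insert A S hAS ih =>
    rw [Finset.card_insert_of_notMem hAS] at hcard ⊢
    have hA : A.card = k := hS A (Finset.mem_insert_self A S)
    have hS' : ∀ X ∈ S, X.card = k := fun X hX => hS X (Finset.mem_insert_of_mem hX)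
    have hIH := ih hS' (by omega)
    have hnew := two_pow_le_card_powerset_sdiff A S fun B hB hAB =>
      hAS (Finset.eq_of_subset_of_card_le hAB (by rw [hA, hS' B hB]) ▸ hB)
    have hpow : 2 ^ (k + 1 - S.card) = 2 * 2 ^ (k - S.card) := by
      rw [← pow_succ', Nat.sub_add_comm (by omega)]
    rw [Finset.biUnion_insert, ← Finset.sdiff_union_self_eq_union,
      Finset.card_union_of_disjoint Finset.sdiff_disjoint, Nat.add_sub_add_right]
    rw [hA] at hnew
    omega

theorem downClosure_eq_biUnion_powerset (n : ℕ) (S : Finset (Finset (Fin n))) :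
    downClosure n S = S.biUnion Finset.powerset := by
  ext X
  simp [downClosure]

theorem two_pow_le_card_downClosure_add (n k : ℕ) (S : Finset (Finset (Fin n)))
    (hS : ∀ X ∈ S, k ≤ X.card) (hcard : S.card ≤ k + 1) :
    2 ^ (k + 1) ≤ (downClosure n S).card + 2 ^ (k + 1 - S.card) := by
  rw [downClosure_eq_biUnion_powerset]
  by_cases h : ∀ X ∈ S, X.card = k
  · exact two_pow_le_card_biUnion_powerset_add k S h hcard
  · push Not at h
    obtain ⟨X, hX, hXk⟩ := h
    calc 2 ^ (k + 1) ≤ 2 ^ X.card :=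
          Nat.pow_le_pow_right two_pos (Nat.lt_of_le_of_ne (hS X hX) hXk.symm)
      _ = X.powerset.card := (Finset.card_powerset X).symm
      _ ≤ (S.biUnion Finset.powerset).card :=
          Finset.card_le_card (Finset.subset_biUnion_of_mem Finset.powerset hX)
      _ ≤ _ := Nat.le_add_right _ _

theorem card_downClosure_image_compl (n : ℕ) (S : Finset (Finset (Fin n))) :
    (downClosure n (S.image compl)).card = (upClosure n S).card := by
  rw [← Finset.card_image_of_injective (upClosure n S) compl_injective]
  congr 1
  ext X
  simp only [downClosure, upClosure, Finset.mem_filter, Finset.mem_univ, true_and,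
    Finset.mem_image, exists_exists_and_eq_and]
  constructor
  · rintro ⟨A, hA, hXA⟩
    exact ⟨Xᶜ, ⟨A, hA, Finset.subset_compl_comm.1 hXA⟩, compl_compl X⟩
  · rintro ⟨Y, ⟨A, hA, hAY⟩, rfl⟩
    exact ⟨A, hA, Finset.compl_subset_compl.2 hAY⟩

theorem two_pow_le_card_upClosure_add (n k : ℕ) (S : Finset (Finset (Fin n)))
    (hS : ∀ X ∈ S, X.card ≤ k) (hcard : S.card ≤ n - k + 1) :
    2 ^ (n - k + 1) ≤ (upClosure n S).card + 2 ^ (n - k + 1 - S.card) := by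
  have hc : (S.image compl).card = S.card := Finset.card_image_of_injective S compl_injective
  rw [← card_downClosure_image_compl, ← hc]
  refine two_pow_le_card_downClosure_add n (n - k) _ ?_ (hc ▸ hcard)
  simp only [Finset.forall_mem_image, Finset.card_compl, Fintype.card_fin]
  exact fun X hX => Nat.sub_le_sub_left (hS X hX) n

/-- for `k ≤ n`: a family of `k+1` sets of size at least `k` has at least
`2^{k+1} − 1` subsets; a family of `k` sets of size at least `k` has at least `2^{k+1} − 2`
subsets; dually, a family of `n−k+1` sets of size at most `k` has at least `2^{n−k+1} − 1`
supersets, and a family of `n−k` sets of size at most `k` has at least `2^{n−k+1} − 2`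
supersets. -/
theorem stmt17 (n k : ℕ) (hk : k ≤ n) :
    (∀ S : Finset (Finset (Fin n)), S.card = k + 1 → (∀ X ∈ S, k ≤ X.card) →
      2 ^ (k + 1) - 1 ≤ (downClosure n S).card) ∧
    (∀ S : Finset (Finset (Fin n)), S.card = k → (∀ X ∈ S, k ≤ X.card) →
      2 ^ (k + 1) - 2 ≤ (downClosure n S).card) ∧
    (∀ S : Finset (Finset (Fin n)), S.card = n - k + 1 → (∀ X ∈ S, X.card ≤ k) →
      2 ^ (n - k + 1) - 1 ≤ (upClosure n S).card) ∧
    (∀ S : Finset (Finset (Fin n)), S.card = n - k → (∀ X ∈ S, X.card ≤ k) →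
      2 ^ (n - k + 1) - 2 ≤ (upClosure n S).card) := by
  refine ⟨fun S hS h => ?_, fun S hS h => ?_, fun S hS h => ?_, fun S hS h => ?_⟩
  · have := two_pow_le_card_downClosure_add n k S h hS.le
    simp only [hS, Nat.sub_self, pow_zero] at this
    omega
  · have := two_pow_le_card_downClosure_add n k S h (by omega)
    simp only [hS, Nat.add_sub_cancel_left, pow_one] at this
    omega
  · have := two_pow_le_card_upClosure_add n k S h hS.le
    simp only [hS, Nat.sub_self, pow_zero] at this
    omega
  · have := two_pow_le_card_upClosure_add n k S h (by omega)
    simp only [hS, Nat.add_sub_cancel_left, pow_one] at this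
    omega
end
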